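/- Let k be a field of characteristic zero, Ω ∈ k[x,y,z] homogeneous (with |x|,|y|,|z| positive weights) of degree |x|+|y|+|z|+w for an integer w, and suppose Ω is irreducible. Then the Poisson algebra P = k[x,y,z]/(Ω − ξ) with bracket {f,g} = Jacobian determinant of (f,g,Ω), admits a w-filtration F with F_{-i}(P) spanned by images of polynomials of Adams degree ≤ i, whose associated graded Poisson algebra is isomorphic to P_Ω = k[x,y,z]/(Ω); in particular P admits a w-valuation. -/

import Mathlib

set_option synthInstance.maxHeartbeats 1000000
set_option maxHeartbeats 1000000

open MvPolynomial

/-- A Poisson bracket on a commutative algebra `A` over `k`. -/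
structure PoissonBracket (k A : Type*) [CommRing k] [CommRing A] [Algebra k A] where
  bracket : A → A → A
  add_left : ∀ a b c : A, bracket (a + b) c = bracket a c + bracket b c
  smul_left : ∀ (r : k) (a b : A), bracket (r • a) b = r • bracket a b
  antisymm : ∀ a b : A, bracket a b = - bracket b a
  leibniz : ∀ a b c : A, bracket a (b * c) = bracket a b * c + bracket a c * b
  jacobi : ∀ a b c : A,
    bracket a (bracket b c) + bracket b (bracket c a) + bracket c (bracket a b) = 0

/-- The Jacobian-determinant Poisson bracket on `k[x,y,z]` with potential `Ω`:
`{f, g} = det (∂(f,g,Ω)/∂(x,y,z))`. -/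
noncomputable def jb {k : Type*} [CommRing k]
    (Ω f g : MvPolynomial (Fin 3) k) : MvPolynomial (Fin 3) k :=
  pderiv 0 f * (pderiv 1 g * pderiv 2 Ω - pderiv 2 g * pderiv 1 Ω)
  - pderiv 1 f * (pderiv 0 g * pderiv 2 Ω - pderiv 2 g * pderiv 0 Ω)
  + pderiv 2 f * (pderiv 0 g * pderiv 1 Ω - pderiv 1 g * pderiv 0 Ω)

/-- The filtration of a ring attached to a degree function `ν`. -/
def valFilt {P : Type*} (ν : P → WithTop ℤ) (i : ℤ) : Set P :=
  {a : P | (i : WithTop ℤ) ≤ ν a}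

/-- `f` has weighted degree at most `n` (integer weights). -/
def Dle {k : Type*} [CommRing k] (W : Fin 3 → ℤ) (f : MvPolynomial (Fin 3) k) (n : ℤ) : Prop :=
  ∀ m, coeff m f ≠ 0 → Finsupp.weight W m ≤ n

section aux
variable {k : Type*} [Field k] {W : Fin 3 → ℤ} {f g : MvPolynomial (Fin 3) k} {m n : ℤ}

lemma Dle.mono (h : Dle W f m) (hmn : m ≤ n) : Dle W f n := fun x hx => (h x hx).trans hmn

lemma Dle.zero : Dle W (0 : MvPolynomial (Fin 3) k) n := fun x hx => by simp at hx

lemma Dle.add (hf : Dle W f n) (hg : Dle W g n) : Dle W (f + g) n := by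
  intro x hx
  by_cases h : coeff x f = 0
  · refine hg x ?_
    intro h'
    simp [h, h'] at hx
  · exact hf x h

lemma Dle.neg (hf : Dle W f n) : Dle W (-f) n := by
  intro x hx
  exact hf x (by simpa using hx)

lemma Dle.sub (hf : Dle W f n) (hg : Dle W g n) : Dle W (f - g) n := by
  rw [sub_eq_add_neg]; exact hf.add hg.neg

lemma Dle.mul (hf : Dle W f m) (hg : Dle W g n) : Dle W (f * g) (m + n) := by
  classical
  intro x hx
  rw [coeff_mul] at hx
  obtain ⟨p, hp, hne⟩ := Finset.exists_ne_zero_of_sum_ne_zero hx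
  rw [Finset.HasAntidiagonal.mem_antidiagonal] at hp
  rw [← hp, map_add]
  exact add_le_add (hf _ (left_ne_zero_of_mul hne)) (hg _ (right_ne_zero_of_mul hne))

lemma Dle.of_hom (h : IsWeightedHomogeneous W f n) : Dle W f n := fun x hx => (h hx).le

lemma Dle.C (c : k) : Dle W (C c : MvPolynomial (Fin 3) k) 0 := Dle.of_hom (isWeightedHomogeneous_C W c)

lemma Dle.C_mul (c : k) (hf : Dle W f n) : Dle W (MvPolynomial.C c * f) n := by
  have := (Dle.C (W := W) c).mul hf
  rwa [zero_add] at this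

lemma Dle.pderiv (i : Fin 3) (hf : Dle W f n) : Dle W (pderiv i f) (n - W i) := by
  intro x hx
  rw [coeff_pderiv] at hx
  have := hf _ (left_ne_zero_of_mul hx)
  rw [map_add, Finsupp.weight_single] at this
  simp at this
  linarith

lemma Dle.comp (hf : Dle W f n) : weightedHomogeneousComponent W m f = 0 ∨ m ≤ n := by
  by_cases h : m ≤ n
  · exact Or.inr h
  · left
    apply weightedHomogeneousComponent_eq_zero'
    intro d hd he
    exact h (he ▸ hf d (mem_support_iff.1 hd))

lemma Dle.comp_zero (hf : Dle W f n) (h : n < m) : weightedHomogeneousComponent W m f = 0 := by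
  rcases hf.comp (m := m) with h' | h'
  · exact h'
  · omega

lemma Dle.sub_comp (hf : Dle W f n) : Dle W (f - weightedHomogeneousComponent W n f) (n - 1) := by
  classical
  intro x hx
  rw [coeff_sub, coeff_weightedHomogeneousComponent] at hx
  split_ifs at hx with h
  · simp at hx
  · have := hf x (by simpa using hx)
    omega

lemma Dle.comp_mul (hf : Dle W f m) (hg : Dle W g n) :
    weightedHomogeneousComponent W (m + n) (f * g)
      = weightedHomogeneousComponent W m f * weightedHomogeneousComponent W n g := by
  have e : f * g = weightedHomogeneousComponent W m f * weightedHomogeneousComponent W n g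
      + ((f - weightedHomogeneousComponent W m f) * g
        + weightedHomogeneousComponent W m f * (g - weightedHomogeneousComponent W n g)) := by ring
  have hm := weightedHomogeneousComponent_isWeightedHomogeneous (w := W) m f
  have hn := weightedHomogeneousComponent_isWeightedHomogeneous (w := W) n g
  have h1 : Dle W ((f - weightedHomogeneousComponent W m f) * g
        + weightedHomogeneousComponent W m f * (g - weightedHomogeneousComponent W n g))
        (m + n - 1) := by
    apply Dle.add
    · exact (hf.sub_comp.mul hg).mono (by omega)
    · exact ((Dle.of_hom hm).mul hg.sub_comp).mono (by omega)
  conv_lhs => rw [e]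
  rw [map_add, h1.comp_zero (by omega), add_zero,
    (hm.mul hn).weightedHomogeneousComponent_same]

lemma exists_top (hf : f ≠ 0) : ∃ n, Dle W f n ∧ weightedHomogeneousComponent W n f ≠ 0 := by
  classical
  have hne : f.support.Nonempty := support_nonempty.2 hf
  obtain ⟨x, hx, hmax⟩ := f.support.exists_max_image (fun x => Finsupp.weight W x) hne
  refine ⟨Finsupp.weight W x, fun y hy => hmax y (mem_support_iff.2 hy), ?_⟩
  intro h
  have := congrArg (coeff x) h
  rw [coeff_weightedHomogeneousComponent, if_pos rfl] at this
  exact mem_support_iff.1 hx (by simpa using this)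

lemma Dle.eq_zero (hW : ∀ i, 0 < W i) (hf : Dle W f n) (hn : n < 0) : f = 0 := by
  ext x
  rw [coeff_zero]
  by_contra h
  have h1 := hf x h
  have : 0 ≤ Finsupp.weight W x := by
    rw [Finsupp.weight_apply]
    exact Finset.sum_nonneg fun i _ => smul_nonneg (by positivity) (hW i).le
  omega

lemma hom_eq_zero (hW : ∀ i, 0 < W i) (hf : IsWeightedHomogeneous W f n) (hn : n < 0) : f = 0 :=
  (Dle.of_hom hf).eq_zero hW hn

lemma comp_mul_hom (hg : IsWeightedHomogeneous W g n) (f : MvPolynomial (Fin 3) k) (m : ℤ) :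
    weightedHomogeneousComponent W m (f * g) = weightedHomogeneousComponent W (m - n) f * g := by
  have key : ∀ (x : Fin 3 →₀ ℕ) (c : k),
      weightedHomogeneousComponent W m (monomial x c * g)
        = weightedHomogeneousComponent W (m - n) (monomial x c) * g := by
    intro x c
    have h1 := isWeightedHomogeneous_monomial W x c rfl
    have h2 := h1.mul hg
    by_cases h : m = Finsupp.weight W x + n
    · subst h
      rw [h2.weightedHomogeneousComponent_same, add_sub_cancel_right,
        h1.weightedHomogeneousComponent_same]
    · rw [h2.weightedHomogeneousComponent_ne _ h,
        h1.weightedHomogeneousComponent_ne _ (by omega), zero_mul]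
  rw [f.as_sum, Finset.sum_mul, map_sum, map_sum, Finset.sum_mul]
  exact Finset.sum_congr rfl fun x _ => key x _

end aux
section aux2
variable {k : Type*} [Field k] {W : Fin 3 → ℤ} {Ω f g : MvPolynomial (Fin 3) k} {m n d w : ℤ}

lemma weight3 (x : Fin 3 →₀ ℕ) : Finsupp.weight W x = x 0 * W 0 + x 1 * W 1 + x 2 * W 2 := by
  rw [Finsupp.weight_apply, Finsupp.sum_fintype _ _ (by simp), Fin.sum_univ_three]
  simp

lemma deg_pos (hW : ∀ i, 0 < W i) (hΩ : IsWeightedHomogeneous W Ω d) (hirr : Irreducible Ω) :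
    0 < d := by
  by_contra hd
  have h : Ω = C (coeff 0 Ω) := by
    ext x
    rw [coeff_C]
    split_ifs with h
    · rw [h]
    · by_contra hne
      have h1 := hΩ hne
      rw [weight3] at h1
      have h0 := hW 0
      have h1' := hW 1
      have h2 := hW 2
      have a0 : 0 ≤ (x 0 : ℤ) * W 0 := by positivity
      have a1 : 0 ≤ (x 1 : ℤ) * W 1 := by positivity
      have a2 : 0 ≤ (x 2 : ℤ) * W 2 := by positivity
      apply h
      have b0 : (x 0 : ℤ) * W 0 = 0 := by omega
      have b1 : (x 1 : ℤ) * W 1 = 0 := by omega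
      have b2 : (x 2 : ℤ) * W 2 = 0 := by omega
      symm
      ext i
      fin_cases i
      · simpa [h0.ne'] using b0
      · simpa [h1'.ne'] using b1
      · simpa [h2.ne'] using b2
  by_cases hc : coeff 0 Ω = 0
  · rw [hc, C_0] at h
    exact hirr.ne_zero h
  · exact hirr.not_isUnit (h ▸ (isUnit_iff_ne_zero.2 hc).map (C : k →+* MvPolynomial (Fin 3) k))

/-- The filtration on the quotient. -/
def Fil (W : Fin 3 → ℤ) (I : Ideal (MvPolynomial (Fin 3) k)) (n : ℤ)
    (a : MvPolynomial (Fin 3) k ⧸ I) : Prop :=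
  ∃ f, Dle W f n ∧ a = Ideal.Quotient.mk I f

lemma key_lemma (hd : 0 < d) (hΩ : IsWeightedHomogeneous W Ω d) (hΩ0 : Ω ≠ 0) (ξ : k)
    (hf : Dle W f n) :
    Fil W (Ideal.span {Ω - C ξ}) (n - 1) (Ideal.Quotient.mk _ f) ↔
      Ω ∣ weightedHomogeneousComponent W n f := by
  constructor
  · rintro ⟨g, hg, h⟩
    rw [Ideal.Quotient.eq, Ideal.mem_span_singleton'] at h
    obtain ⟨h, hh⟩ := h
    have hfn : weightedHomogeneousComponent W n f = weightedHomogeneousComponent W n (f - g) := by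
      rw [map_sub, hg.comp_zero (by omega), sub_zero]
    have hcomp : ∀ j, weightedHomogeneousComponent W j (f - g) =
        weightedHomogeneousComponent W (j - d) h * Ω - C ξ * weightedHomogeneousComponent W j h := by
      intro j
      rw [← hh, mul_sub, map_sub, comp_mul_hom hΩ, mul_comm h (C ξ),
        weightedHomogeneousComponent_C_mul]
    by_cases h0 : h = 0
    · rw [hfn, ← hh, h0]; simp
    obtain ⟨N, hN, hN0⟩ := exists_top (W := W) h0
    have h1 := hcomp (N + d)
    rw [add_sub_cancel_right, hN.comp_zero (by omega : N < N + d), mul_zero, sub_zero] at h1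
    have h2 : N + d ≤ n := by
      rcases (hf.sub (hg.mono (by omega : n - 1 ≤ n))).comp (m := N + d) with h3 | h3
      · rw [h3] at h1
        exact absurd h1.symm (mul_ne_zero hN0 hΩ0)
      · exact h3
    rw [hfn, hcomp n, hN.comp_zero (by omega : N < n), mul_zero, sub_zero]
    exact dvd_mul_left _ _
  · rintro ⟨h, hh⟩
    have h1 : weightedHomogeneousComponent W n f = weightedHomogeneousComponent W (n - d) h * Ω := by
      rw [← comp_mul_hom hΩ, mul_comm h, ← hh,
        (weightedHomogeneousComponent_isWeightedHomogeneous n f).weightedHomogeneousComponent_same]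
    have hh' := weightedHomogeneousComponent_isWeightedHomogeneous (w := W) (n - d) h
    set h' := weightedHomogeneousComponent W (n - d) h
    refine ⟨f - h' * (Ω - C ξ), ?_, ?_⟩
    · have e : f - h' * (Ω - C ξ) = (f - weightedHomogeneousComponent W n f) + C ξ * h' := by
        rw [h1]; ring
      rw [e]
      exact hf.sub_comp.add (((Dle.of_hom hh').C_mul ξ).mono (by omega))
    · rw [Ideal.Quotient.eq, sub_sub_cancel]
      exact Ideal.mul_mem_left _ _ (Ideal.mem_span_singleton_self _)

lemma jb_dle (hΩ : Dle W Ω d) (hw : d = W 0 + W 1 + W 2 + w)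
    (hf : Dle W f m) (hg : Dle W g n) : Dle W (jb Ω f g) (m + n + w) := by
  unfold jb
  have A : ∀ i j l : Fin 3, W i + W j + W l = W 0 + W 1 + W 2 →
      Dle W (pderiv i f * (pderiv j g * pderiv l Ω)) (m + n + w) := fun i j l h =>
    ((hf.pderiv i).mul ((hg.pderiv j).mul (hΩ.pderiv l))).mono (by omega)
  simp only [mul_sub]
  refine Dle.add (Dle.sub (Dle.sub ?_ ?_) (Dle.sub ?_ ?_)) (Dle.sub ?_ ?_) <;> apply A <;> ring

lemma jb_hom (hΩ : IsWeightedHomogeneous W Ω d) (hw : d = W 0 + W 1 + W 2 + w)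
    (hf : IsWeightedHomogeneous W f m) (hg : IsWeightedHomogeneous W g n) :
    IsWeightedHomogeneous W (jb Ω f g) (m + n + w) := by
  unfold jb
  have A : ∀ i j l : Fin 3, W i + W j + W l = W 0 + W 1 + W 2 →
      IsWeightedHomogeneous W (pderiv i f * (pderiv j g * pderiv l Ω)) (m + n + w) := by
    intro i j l h
    have e : m + n + w = (m - W i) + ((n - W j) + (d - W l)) := by omega
    rw [e]
    exact (hf.pderiv (by ring)).mul ((hg.pderiv (by ring)).mul (hΩ.pderiv (by ring)))
  simp only [mul_sub]
  refine IsWeightedHomogeneous.add (IsWeightedHomogeneous.sub (IsWeightedHomogeneous.sub ?_ ?_)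
    (IsWeightedHomogeneous.sub ?_ ?_)) (IsWeightedHomogeneous.sub ?_ ?_) <;> apply A <;> ring

variable {I : Ideal (MvPolynomial (Fin 3) k)} {a b : MvPolynomial (Fin 3) k ⧸ I}

lemma Fil.mono (h : Fil W I m a) (hmn : m ≤ n) : Fil W I n a := by
  obtain ⟨f, hf, rfl⟩ := h
  exact ⟨f, hf.mono hmn, rfl⟩

lemma Fil.zero : Fil W I n 0 := ⟨0, Dle.zero, by simp⟩

lemma Fil.add (ha : Fil W I n a) (hb : Fil W I n b) : Fil W I n (a + b) := by
  obtain ⟨f, hf, rfl⟩ := ha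
  obtain ⟨g, hg, rfl⟩ := hb
  exact ⟨f + g, hf.add hg, by simp⟩

lemma Fil.mul (ha : Fil W I m a) (hb : Fil W I n b) : Fil W I (m + n) (a * b) := by
  obtain ⟨f, hf, rfl⟩ := ha
  obtain ⟨g, hg, rfl⟩ := hb
  exact ⟨f * g, hf.mul hg, by simp⟩

lemma Fil.neg_eq (hW : ∀ i, 0 < W i) (ha : Fil W I n a) (hn : n < 0) : a = 0 := by
  obtain ⟨f, hf, rfl⟩ := ha
  rw [hf.eq_zero hW hn, map_zero]

lemma exists_nu (hW : ∀ i, 0 < W i) (I : Ideal (MvPolynomial (Fin 3) k)) :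
    ∃ ν : (MvPolynomial (Fin 3) k ⧸ I) → WithTop ℤ,
      ∀ (i : ℤ) a, (i : WithTop ℤ) ≤ ν a ↔ Fil W I (-i) a := by
  have h : ∀ a : MvPolynomial (Fin 3) k ⧸ I, ∃ v : WithTop ℤ,
      ∀ i : ℤ, (i : WithTop ℤ) ≤ v ↔ Fil W I (-i) a := by
    intro a
    by_cases ha : a = 0
    · refine ⟨⊤, fun i => ?_⟩
      subst ha
      simp [Fil.zero]
    · obtain ⟨n, hn, hmin⟩ := Int.exists_least_of_bdd (P := fun n => Fil W I n a)
        ⟨0, fun z hz => by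
          by_contra h
          exact ha (hz.neg_eq hW (by omega))⟩
        (by
          obtain ⟨f, rfl⟩ := Ideal.Quotient.mk_surjective a
          have : f ≠ 0 := by rintro rfl; simp at ha
          obtain ⟨n, hn, -⟩ := exists_top (W := W) this
          exact ⟨n, f, hn, rfl⟩)
      refine ⟨((-n : ℤ) : WithTop ℤ), fun i => ?_⟩
      rw [WithTop.coe_le_coe]
      constructor
      · intro h
        exact Fil.mono hn (by omega)
      · intro h
        have := hmin _ h
        omega
  choose ν hν using h
  exact ⟨ν, fun i a => hν a i⟩

lemma wtop_le {u v : WithTop ℤ} (h : ∀ i : ℤ, (i : WithTop ℤ) ≤ u → (i : WithTop ℤ) ≤ v) : u ≤ v := by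
  induction u with
  | top =>
    induction v with
    | top => exact le_rfl
    | coe v =>
      have := h (v + 1) le_top
      rw [WithTop.coe_le_coe] at this
      omega
  | coe u => exact h u le_rfl

section val
variable {ξ : k} {ν : (MvPolynomial (Fin 3) k ⧸ Ideal.span {Ω - C ξ}) → WithTop ℤ}

lemma nu_top (hW : ∀ i, 0 < W i) 
    (hν : ∀ (i : ℤ) a, (i : WithTop ℤ) ≤ ν a ↔ Fil W (Ideal.span {Ω - C ξ}) (-i) a) (a) :
    ν a = ⊤ ↔ a = 0 := by
  constructor
  · intro h
    have := (hν 1 a).1 (h ▸ le_top)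
    exact this.neg_eq hW (by omega)
  · rintro rfl
    apply top_le_iff.1
    apply wtop_le
    intro i _
    exact (hν i 0).2 Fil.zero

lemma nu_add
    (hν : ∀ (i : ℤ) a, (i : WithTop ℤ) ≤ ν a ↔ Fil W (Ideal.span {Ω - C ξ}) (-i) a) (a b) :
    min (ν a) (ν b) ≤ ν (a + b) := by
  apply wtop_le
  intro i hi
  rw [le_min_iff, hν, hν] at hi
  exact (hν _ _).2 (hi.1.add hi.2)

lemma nu_eq
    (hν : ∀ (i : ℤ) a, (i : WithTop ℤ) ≤ ν a ↔ Fil W (Ideal.span {Ω - C ξ}) (-i) a) (a) (n : ℤ) :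
    ν a = ((-n : ℤ) : WithTop ℤ) ↔ Fil W (Ideal.span {Ω - C ξ}) n a ∧
      ¬ Fil W (Ideal.span {Ω - C ξ}) (n - 1) a := by
  have h1 := hν (-n) a
  have h2 := hν (-n + 1) a
  rw [neg_neg] at h1
  rw [show -(-n + 1) = n - 1 by ring] at h2
  rw [← h1, ← h2]
  generalize ν a = v
  induction v with
  | top => exact ⟨fun h => absurd h.symm WithTop.coe_ne_top, fun h => absurd le_top h.2⟩
  | coe v =>
    rw [WithTop.coe_le_coe, WithTop.coe_le_coe, WithTop.coe_eq_coe]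
    omega

lemma nu_mul (hW : ∀ i, 0 < W i) (hd : 0 < d) (hΩ : IsWeightedHomogeneous W Ω d) (hp : Prime Ω)
    (hν : ∀ (i : ℤ) a, (i : WithTop ℤ) ≤ ν a ↔ Fil W (Ideal.span {Ω - C ξ}) (-i) a) (a b) :
    ν (a * b) = ν a + ν b := by
  have htop := nu_top hW hν
  by_cases ha : a = 0
  · subst ha
    rw [zero_mul, (htop 0).2 rfl, WithTop.top_add]
  by_cases hb : b = 0
  · subst hb
    rw [mul_zero, (htop 0).2 rfl, WithTop.add_top]
  have hex : ∀ a, a ≠ 0 → ∃ n : ℤ, ν a = ((-n : ℤ) : WithTop ℤ) := by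
    intro a ha
    obtain ⟨n, hn⟩ := WithTop.ne_top_iff_exists.1 (fun h => ha ((htop a).1 h))
    exact ⟨-n, by rw [neg_neg, hn]⟩
  obtain ⟨m, hm⟩ := hex a ha
  obtain ⟨n, hn⟩ := hex b hb
  rw [hm, hn, ← WithTop.coe_add, ← neg_add, nu_eq hν]
  rw [nu_eq hν] at hm hn
  obtain ⟨⟨f, hf, rfl⟩, hf'⟩ := hm
  obtain ⟨⟨g, hg, rfl⟩, hg'⟩ := hn
  rw [key_lemma hd hΩ hp.ne_zero ξ hf] at hf'
  rw [key_lemma hd hΩ hp.ne_zero ξ hg] at hg'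
  rw [← map_mul]
  refine ⟨⟨_, hf.mul hg, rfl⟩, ?_⟩
  rw [key_lemma hd hΩ hp.ne_zero ξ (hf.mul hg), hf.comp_mul hg]
  intro h
  rcases hp.dvd_or_dvd h with h | h
  · exact hf' h
  · exact hg' h

lemma nu_const (hd : 0 < d) (hΩ : IsWeightedHomogeneous W Ω d) (hp : Prime Ω)
    (hν : ∀ (i : ℤ) a, (i : WithTop ℤ) ≤ ν a ↔ Fil W (Ideal.span {Ω - C ξ}) (-i) a)
    (c : k) (hc : c ≠ 0) : ν (Ideal.Quotient.mk _ (C c)) = 0 := by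
  have h0 : (0 : WithTop ℤ) = ((-0 : ℤ) : WithTop ℤ) := by simp
  rw [h0, nu_eq hν]
  refine ⟨⟨_, Dle.C c, rfl⟩, ?_⟩
  rw [key_lemma hd hΩ hp.ne_zero ξ (Dle.C c),
    (isWeightedHomogeneous_C W c).weightedHomogeneousComponent_same]
  intro h
  exact hp.not_isUnit (isUnit_of_dvd_unit h
    ((isUnit_iff_ne_zero.2 hc).map (C : k →+* MvPolynomial (Fin 3) k)))

lemma nu_bracket (hW : ∀ i, 0 < W i) (hΩ : IsWeightedHomogeneous W Ω d) 
    (hw : d = W 0 + W 1 + W 2 + w)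
    (hν : ∀ (i : ℤ) a, (i : WithTop ℤ) ≤ ν a ↔ Fil W (Ideal.span {Ω - C ξ}) (-i) a)
    (Pb : (MvPolynomial (Fin 3) k ⧸ Ideal.span {Ω - C ξ}) →
          (MvPolynomial (Fin 3) k ⧸ Ideal.span {Ω - C ξ}) →
          (MvPolynomial (Fin 3) k ⧸ Ideal.span {Ω - C ξ}))
    (hPb : ∀ f g : MvPolynomial (Fin 3) k,
      Pb (Ideal.Quotient.mk (Ideal.span {Ω - C ξ}) f)
         (Ideal.Quotient.mk (Ideal.span {Ω - C ξ}) g)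
        = Ideal.Quotient.mk (Ideal.span {Ω - C ξ}) (jb Ω f g)) (a b) :
    ν a + ν b ≤ ν (Pb a b) + (w : WithTop ℤ) := by
  have htop := nu_top hW hν
  have hz : a = 0 ∨ b = 0 → Pb a b = 0 := by
    obtain ⟨f, rfl⟩ := Ideal.Quotient.mk_surjective a
    obtain ⟨g, rfl⟩ := Ideal.Quotient.mk_surjective b
    rintro (h | h)
    · rw [h, ← map_zero (Ideal.Quotient.mk (Ideal.span {Ω - C ξ})), hPb]
      simp [jb]
    · rw [h, ← map_zero (Ideal.Quotient.mk (Ideal.span {Ω - C ξ})), hPb]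
      simp [jb]
  by_cases ha : a = 0
  · rw [hz (Or.inl ha), (htop 0).2 rfl, WithTop.top_add]
    exact le_top
  by_cases hb : b = 0
  · rw [hz (Or.inr hb), (htop 0).2 rfl, WithTop.top_add]
    exact le_top
  obtain ⟨m, hm⟩ := WithTop.ne_top_iff_exists.1 (fun h => ha ((htop a).1 h))
  obtain ⟨n, hn⟩ := WithTop.ne_top_iff_exists.1 (fun h => hb ((htop b).1 h))
  obtain ⟨f, hf, rfl⟩ := (hν m a).1 hm.le
  obtain ⟨g, hg, rfl⟩ := (hν n b).1 hn.le
  have h := (hν (m + n - w) (Pb _ _)).2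
    ⟨jb Ω f g, (jb_dle (Dle.of_hom hΩ) hw hf hg).mono (by omega), hPb f g⟩
  rw [← hm, ← hn]
  calc (m : WithTop ℤ) + n = ((m + n - w : ℤ) : WithTop ℤ) + (w : WithTop ℤ) := by
        rw [← WithTop.coe_add, ← WithTop.coe_add]; congr 1; ring
    _ ≤ _ := by gcongr

end val
end aux2
section gr

lemma jb_add_left {k : Type*} [CommRing k] (Ω f f' g : MvPolynomial (Fin 3) k) :
    jb Ω (f + f') g = jb Ω f g + jb Ω f' g := by
  simp only [jb, map_add]; ring

lemma jb_add_right {k : Type*} [CommRing k] (Ω f g g' : MvPolynomial (Fin 3) k) :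
    jb Ω f (g + g') = jb Ω f g + jb Ω f g' := by
  simp only [jb, map_add]; ring

lemma gr_iso {k : Type} [Field k] {W : Fin 3 → ℤ} (hW : ∀ i, 0 < W i)
    {Ω : MvPolynomial (Fin 3) k} {d w : ℤ} (hd : 0 < d) (hΩ : IsWeightedHomogeneous W Ω d)
    (hΩ0 : Ω ≠ 0) (hw : d = W 0 + W 1 + W 2 + w) (ξ : k)
    (Pb : (MvPolynomial (Fin 3) k ⧸ Ideal.span {Ω - C ξ}) →
          (MvPolynomial (Fin 3) k ⧸ Ideal.span {Ω - C ξ}) →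
          (MvPolynomial (Fin 3) k ⧸ Ideal.span {Ω - C ξ}))
    (hPb : ∀ f g : MvPolynomial (Fin 3) k,
      Pb (Ideal.Quotient.mk (Ideal.span {Ω - C ξ}) f)
         (Ideal.Quotient.mk (Ideal.span {Ω - C ξ}) g)
        = Ideal.Quotient.mk (Ideal.span {Ω - C ξ}) (jb Ω f g))
    (PbΩ : (MvPolynomial (Fin 3) k ⧸ Ideal.span {Ω}) →
           (MvPolynomial (Fin 3) k ⧸ Ideal.span {Ω}) →
           (MvPolynomial (Fin 3) k ⧸ Ideal.span {Ω}))
    (hPbΩ : ∀ f g : MvPolynomial (Fin 3) k,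
      PbΩ (Ideal.Quotient.mk (Ideal.span {Ω}) f)
          (Ideal.Quotient.mk (Ideal.span {Ω}) g)
        = Ideal.Quotient.mk (Ideal.span {Ω}) (jb Ω f g))
    (V : ℤ → Set (MvPolynomial (Fin 3) k ⧸ Ideal.span {Ω - C ξ}))
    (hV : ∀ i a, a ∈ V i ↔ Fil W (Ideal.span {Ω - C ξ}) (-i) a)
    (G : Type) [CommRing G] [Algebra k G] (PG : PoissonBracket k G)
    (𝒢 : ℤ → Submodule k G) (φ : ℤ → (MvPolynomial (Fin 3) k ⧸ Ideal.span {Ω - C ξ}) → G)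
    (hφm : ∀ i : ℤ, ∀ a ∈ V i, φ i a ∈ 𝒢 i)
    (hφadd : ∀ i : ℤ, ∀ a ∈ V i, ∀ b ∈ V i, φ i (a + b) = φ i a + φ i b)
    (hφsmul : ∀ (i : ℤ) (c : k), ∀ a ∈ V i, φ i (c • a) = c • φ i a)
    (hφker : ∀ i : ℤ, ∀ a ∈ V i, (φ i a = 0 ↔ a ∈ V (i + 1)))
    (hφsurj : ∀ i : ℤ, ∀ g ∈ 𝒢 i, ∃ a ∈ V i, φ i a = g)
    (hφone : φ 0 1 = 1)
    (hφmul : ∀ i j : ℤ, ∀ a ∈ V i, ∀ b ∈ V j, φ (i + j) (a * b) = φ i a * φ j b)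
    (hint : DirectSum.IsInternal 𝒢)
    (hbr : ∀ i j : ℤ, ∀ a ∈ V i, ∀ b ∈ V j,
          PG.bracket (φ i a) (φ j b) = φ (i + j - w) (Pb a b)) :
    ∃ e : G ≃ₐ[k] (MvPolynomial (Fin 3) k ⧸ Ideal.span {Ω}),
          ∀ a b : G, e (PG.bracket a b) = PbΩ (e a) (e b) := by
  classical
  have memV : ∀ {n : ℤ} {f : MvPolynomial (Fin 3) k}, Dle W f n →
      Ideal.Quotient.mk (Ideal.span {Ω - C ξ}) f ∈ V (-n) := by
    intro n f hf
    rw [hV, neg_neg]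
    exact ⟨f, hf, rfl⟩
  have zeroV : ∀ i, (0 : MvPolynomial (Fin 3) k ⧸ Ideal.span {Ω - C ξ}) ∈ V i := fun i =>
    (hV i 0).2 Fil.zero
  have φ0 : ∀ i, φ i 0 = 0 := fun i => (hφker i 0 (zeroV i)).2 (zeroV _)
  let ψ : MvPolynomial (Fin 3) k →ₐ[k] G :=
    aeval fun i => φ (-W i) (Ideal.Quotient.mk _ (X i))
  -- monomials
  have hmon1 : ∀ x : Fin 3 →₀ ℕ, ψ (monomial x 1) =
      φ (-Finsupp.weight W x) (Ideal.Quotient.mk _ (monomial x 1)) := by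
    intro x
    induction x using Finsupp.induction_linear with
    | zero => simp [hφone]
    | add x y hx hy =>
      have e : (monomial (x + y) (1 : k)) = monomial x 1 * monomial y 1 := by
        rw [monomial_mul, one_mul]
      rw [e, map_mul, hx, hy, map_mul, map_add, neg_add, hφmul]
      · exact memV (Dle.of_hom (isWeightedHomogeneous_monomial W x 1 rfl))
      · exact memV (Dle.of_hom (isWeightedHomogeneous_monomial W y 1 rfl))
    | single i n =>
      induction n with
      | zero => simp [hφone]
      | succ n ih =>
        have e : (monomial (Finsupp.single i (n + 1)) (1 : k))
            = monomial (Finsupp.single i n) 1 * X i := by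
          rw [X, monomial_mul, one_mul, ← Finsupp.single_add]
        have e2 : Finsupp.weight W (Finsupp.single i (n + 1))
            = Finsupp.weight W (Finsupp.single i n) + W i := by
          rw [Finsupp.weight_single, Finsupp.weight_single, succ_nsmul]
        rw [e, map_mul, ih, map_mul, e2, neg_add, hφmul]
        · simp [ψ]
        · exact memV (Dle.of_hom (isWeightedHomogeneous_monomial W _ 1 rfl))
        · exact memV (Dle.of_hom (isWeightedHomogeneous_X k W i))
  have hmon : ∀ (x : Fin 3 →₀ ℕ) (c : k), ψ (monomial x c) =
      φ (-Finsupp.weight W x) (Ideal.Quotient.mk _ (monomial x c)) := by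
    intro x c
    have e : (monomial x c) = c • (monomial x (1 : k)) := by
      rw [smul_monomial, smul_eq_mul, mul_one]
    have e2 : Ideal.Quotient.mk (Ideal.span {Ω - C ξ}) (c • (monomial x (1 : k)))
        = c • Ideal.Quotient.mk (Ideal.span {Ω - C ξ}) (monomial x (1 : k)) := rfl
    rw [e, map_smul, hmon1, e2, hφsmul]
    exact memV (Dle.of_hom (isWeightedHomogeneous_monomial W x 1 rfl))
  have hsum : ∀ (n : ℤ) (s : Finset (Fin 3 →₀ ℕ)) (c : (Fin 3 →₀ ℕ) → k),
      (∀ x ∈ s, Finsupp.weight W x = n) →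
      Dle W (∑ x ∈ s, monomial x (c x)) n ∧
      ψ (∑ x ∈ s, monomial x (c x)) =
        φ (-n) (Ideal.Quotient.mk _ (∑ x ∈ s, monomial x (c x))) := by
    intro n s c
    induction s using Finset.induction_on with
    | empty => intro _; simp [φ0, Dle.zero]
    | insert x s hx ih =>
      intro h
      obtain ⟨i1, i2⟩ := ih fun y hy => h y (Finset.mem_insert_of_mem hy)
      have hxn := h x (Finset.mem_insert_self _ _)
      have i3 : Dle W (monomial x (c x)) n :=
        Dle.of_hom (isWeightedHomogeneous_monomial W x _ hxn)
      rw [Finset.sum_insert hx]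
      refine ⟨i3.add i1, ?_⟩
      rw [map_add, i2, hmon, map_add, hxn, hφadd _ _ (memV i3) _ (memV i1)]
  have hhom : ∀ {n : ℤ} {f : MvPolynomial (Fin 3) k}, IsWeightedHomogeneous W f n →
      ψ f = φ (-n) (Ideal.Quotient.mk _ f) := by
    intro n f hf
    have := (hsum n f.support (fun x => coeff x f)
      (fun x hx => hf (mem_support_iff.1 hx))).2
    rwa [← f.as_sum] at this
  -- kernel on homogeneous elements
  have hkerhom : ∀ {n : ℤ} {f : MvPolynomial (Fin 3) k}, IsWeightedHomogeneous W f n →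
      (ψ f = 0 ↔ Ω ∣ f) := by
    intro n f hf
    rw [hhom hf, hφker _ _ (memV (Dle.of_hom hf)), hV,
      show -(-n + 1) = n - 1 by ring, key_lemma hd hΩ hΩ0 ξ (Dle.of_hom hf),
      hf.weightedHomogeneousComponent_same]
  -- decomposition into components
  have hdec : ∀ f : MvPolynomial (Fin 3) k, ∃ s : Finset ℤ,
      f = ∑ n ∈ s, weightedHomogeneousComponent W n f := by
    intro f
    refine ⟨(weightedHomogeneousComponent_finsupp (w := W) f).toFinset, ?_⟩
    rw [← finsum_eq_sum _ (weightedHomogeneousComponent_finsupp (w := W) f),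
      sum_weightedHomogeneousComponent]
  have hcomp := fun (n : ℤ) (f : MvPolynomial (Fin 3) k) =>
    weightedHomogeneousComponent_isWeightedHomogeneous (w := W) n f
  have hindep : iSupIndep 𝒢 := hint.submodule_iSupIndep
  have hker : RingHom.ker ψ = Ideal.span {Ω} := by
    ext f
    rw [RingHom.mem_ker, Ideal.mem_span_singleton]
    constructor
    · intro h
      obtain ⟨s, hs⟩ := hdec f
      rw [hs, map_sum] at h
      have h2 := (iSupIndep_iff_finsetSum_eq_zero_imp_eq_zero (fun n : ℤ => 𝒢 (-n))).1
        (hindep.comp neg_injective) s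
        (fun n => ψ (weightedHomogeneousComponent W n f))
        (fun n _ => by
          change ψ _ ∈ 𝒢 (-n)
          rw [hhom (hcomp n f)]
          exact hφm _ _ (memV (Dle.of_hom (hcomp n f)))) h
      rw [hs]
      exact Finset.dvd_sum fun n hn => (hkerhom (hcomp n f)).1 (h2 n hn)
    · rintro ⟨h, rfl⟩
      rw [map_mul, (hkerhom hΩ).2 dvd_rfl, zero_mul]
  have hsurj : Function.Surjective ψ := by
    have : (⊤ : Submodule k G) ≤ LinearMap.range ψ.toLinearMap := by
      rw [← hint.submodule_iSup_eq_top]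
      apply iSup_le
      intro i g hg
      obtain ⟨a, ha, rfl⟩ := hφsurj i g hg
      obtain ⟨f, hf, rfl⟩ := (hV i a).1 ha
      refine ⟨weightedHomogeneousComponent W (-i) f, ?_⟩
      have e : f = weightedHomogeneousComponent W (-i) f +
        (f - weightedHomogeneousComponent W (-i) f) := by ring
      have m1 := memV (Dle.of_hom (hcomp (-i) f))
      have m2 := memV (hf.sub_comp)
      have m3 := memV ((hf.sub_comp).mono (by omega : -i - 1 ≤ -i))
      rw [neg_neg] at m1 m3
      rw [show -(-i - 1) = i + 1 by ring] at m2
      conv_rhs => rw [e]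
      rw [map_add, hφadd _ _ m1 _ m3, (hφker _ _ m3).2 m2, add_zero]
      have := hhom (hcomp (-i) f)
      rw [neg_neg] at this
      exact this
    intro g
    obtain ⟨f, hf⟩ := this (Submodule.mem_top (x := g))
    exact ⟨f, hf⟩
  have add_right : ∀ a b c, PG.bracket a (b + c) = PG.bracket a b + PG.bracket a c := by
    intro a b c
    rw [PG.antisymm, PG.add_left, neg_add, ← PG.antisymm, ← PG.antisymm]
  have hbr1 : ∀ {m n : ℤ} {f g : MvPolynomial (Fin 3) k}, IsWeightedHomogeneous W f m →
      IsWeightedHomogeneous W g n → PG.bracket (ψ f) (ψ g) = ψ (jb Ω f g) := by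
    intro m n f g hf hg
    rw [hhom hf, hhom hg, hbr _ _ _ (memV (Dle.of_hom hf)) _ (memV (Dle.of_hom hg)), hPb,
      hhom (jb_hom hΩ hw hf hg)]
    congr 1
    ring
  have hbr2 : ∀ f g : MvPolynomial (Fin 3) k, PG.bracket (ψ f) (ψ g) = ψ (jb Ω f g) := by
    intro f g
    induction f using MvPolynomial.induction_on' with
    | monomial x a =>
      induction g using MvPolynomial.induction_on' with
      | monomial y b =>
        exact hbr1 (isWeightedHomogeneous_monomial W x a rfl)
          (isWeightedHomogeneous_monomial W y b rfl)
      | add p q hp hq => rw [map_add, add_right, jb_add_right, map_add, hp, hq]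
    | add p q hp hq => rw [map_add, PG.add_left, jb_add_left, map_add, hp, hq]
  let e1 := Ideal.quotientKerAlgEquivOfSurjective hsurj
  let e2 := Ideal.quotientEquivAlgOfEq k hker
  let e := e1.symm.trans e2
  have he : ∀ f, e (ψ f) = Ideal.Quotient.mk _ f := by
    intro f
    have : e1.symm (ψ f) = Ideal.Quotient.mk _ f := by
      rw [AlgEquiv.symm_apply_eq]
      rfl
    simp only [e, AlgEquiv.trans_apply, this]
    rfl
  refine ⟨e, fun a b => ?_⟩
  obtain ⟨f, rfl⟩ := hsurj a
  obtain ⟨g, rfl⟩ := hsurj b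
  rw [hbr2, he, he, he, hPbΩ]
end gr
/-- let `k` have characteristic zero, let `Ω ∈ k[x,y,z]` be
weighted-homogeneous of degree `|x| + |y| + |z| + w` (with positive weights
`|x|, |y|, |z|` and `w ∈ ℤ`) and irreducible.  Then the Poisson algebra
`P = k[x,y,z]/(Ω − ξ)` with the Jacobian bracket `{f,g} = det ∂(f,g,Ω)` admits
a `w`-filtration `F`, with `F (−i)` the span of the images of the polynomials
of weighted (Adams) degree ≤ i, whose associated graded Poisson algebra is
isomorphic to `P_Ω = k[x,y,z]/(Ω)`; in particular `P` admits a `w`-valuation.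
We state this as: there is a `w`-valuation `ν` on `P` whose filtration is the
one described, and every realization `(G, 𝒢, φ)` of the associated graded
algebra of this filtration is isomorphic, as a Poisson algebra, to `P_Ω`. -/
theorem stmt17 (k : Type) [Field k] [CharZero k]
    (wt : Fin 3 → ℕ) (hwt : ∀ i, 0 < wt i)
    (Ω : MvPolynomial (Fin 3) k) (d : ℕ)
    (hhom : Ω.IsWeightedHomogeneous wt d)
    (w : ℤ) (hw : (d : ℤ) = (wt 0 : ℤ) + (wt 1 : ℤ) + (wt 2 : ℤ) + w)
    (hirr : Irreducible Ω) (ξ : k)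
    -- the induced Poisson bracket on `P = k[x,y,z]/(Ω − ξ)`:
    (Pb : (MvPolynomial (Fin 3) k ⧸ Ideal.span {Ω - C ξ}) →
          (MvPolynomial (Fin 3) k ⧸ Ideal.span {Ω - C ξ}) →
          (MvPolynomial (Fin 3) k ⧸ Ideal.span {Ω - C ξ}))
    (hPb : ∀ f g : MvPolynomial (Fin 3) k,
      Pb (Ideal.Quotient.mk (Ideal.span {Ω - C ξ}) f)
         (Ideal.Quotient.mk (Ideal.span {Ω - C ξ}) g)
        = Ideal.Quotient.mk (Ideal.span {Ω - C ξ}) (jb Ω f g))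
    -- the induced Poisson bracket on `P_Ω = k[x,y,z]/(Ω)`:
    (PbΩ : (MvPolynomial (Fin 3) k ⧸ Ideal.span {Ω}) →
           (MvPolynomial (Fin 3) k ⧸ Ideal.span {Ω}) →
           (MvPolynomial (Fin 3) k ⧸ Ideal.span {Ω}))
    (hPbΩ : ∀ f g : MvPolynomial (Fin 3) k,
      PbΩ (Ideal.Quotient.mk (Ideal.span {Ω}) f)
          (Ideal.Quotient.mk (Ideal.span {Ω}) g)
        = Ideal.Quotient.mk (Ideal.span {Ω}) (jb Ω f g)) :
    ∃ ν : (MvPolynomial (Fin 3) k ⧸ Ideal.span {Ω - C ξ}) → WithTop ℤ,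
      -- `ν` is a valuation on `P`
      (∀ a, ν a = ⊤ ↔ a = 0) ∧
      (∀ c : k, c ≠ 0 →
        ν (algebraMap k (MvPolynomial (Fin 3) k ⧸ Ideal.span {Ω - C ξ}) c) = 0) ∧
      (∀ a b, ν (a * b) = ν a + ν b) ∧
      (∀ a b, min (ν a) (ν b) ≤ ν (a + b)) ∧
      -- `ν` is a `w`-valuation
      (∀ a b, ν a + ν b ≤ ν (Pb a b) + (w : WithTop ℤ)) ∧
      -- its filtration is as described: `F (−i)` is the image of the
      -- polynomials of weighted degree ≤ i
      (∀ (i : ℕ) (a : MvPolynomial (Fin 3) k ⧸ Ideal.span {Ω - C ξ}),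
        ((-(i : ℤ) : ℤ) : WithTop ℤ) ≤ ν a ↔
          ∃ f : MvPolynomial (Fin 3) k, weightedTotalDegree wt f ≤ i ∧
            a = Ideal.Quotient.mk (Ideal.span {Ω - C ξ}) f) ∧
      -- the associated graded Poisson algebra is isomorphic to `P_Ω`
      (∀ (G : Type) [CommRing G] [Algebra k G], ∀ (PG : PoissonBracket k G)
        (𝒢 : ℤ → Submodule k G) (φ : ℤ → (MvPolynomial (Fin 3) k ⧸ Ideal.span {Ω - C ξ}) → G),
        (∀ i : ℤ, ∀ a ∈ valFilt ν i, φ i a ∈ 𝒢 i) →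
        (∀ i : ℤ, ∀ a ∈ valFilt ν i, ∀ b ∈ valFilt ν i,
          φ i (a + b) = φ i a + φ i b) →
        (∀ (i : ℤ) (c : k), ∀ a ∈ valFilt ν i, φ i (c • a) = c • φ i a) →
        (∀ i : ℤ, ∀ a ∈ valFilt ν i, (φ i a = 0 ↔ a ∈ valFilt ν (i + 1))) →
        (∀ i : ℤ, ∀ g ∈ 𝒢 i, ∃ a ∈ valFilt ν i, φ i a = g) →
        φ 0 1 = 1 →
        (∀ i j : ℤ, ∀ a ∈ valFilt ν i, ∀ b ∈ valFilt ν j,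
          φ (i + j) (a * b) = φ i a * φ j b) →
        DirectSum.IsInternal 𝒢 →
        (∀ i j : ℤ, ∀ a ∈ valFilt ν i, ∀ b ∈ valFilt ν j,
          PG.bracket (φ i a) (φ j b) = φ (i + j - w) (Pb a b)) →
        ∃ e : G ≃ₐ[k] (MvPolynomial (Fin 3) k ⧸ Ideal.span {Ω}),
          ∀ a b : G, e (PG.bracket a b) = PbΩ (e a) (e b)) := by
  have hW : ∀ i, (0 : ℤ) < (fun i => (wt i : ℤ)) i := fun i => by simpa using hwt i
  have hcast : ∀ x : Fin 3 →₀ ℕ,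
      Finsupp.weight (fun i => (wt i : ℤ)) x = ((Finsupp.weight wt x : ℕ) : ℤ) := by
    intro x
    rw [Finsupp.weight_apply, Finsupp.weight_apply, Finsupp.sum, Finsupp.sum]
    push_cast
    simp
  have hΩ : IsWeightedHomogeneous (fun i => (wt i : ℤ)) Ω (d : ℤ) := by
    intro x hx
    rw [hcast, hhom hx]
  have hdle : ∀ (f : MvPolynomial (Fin 3) k) (n : ℕ),
      weightedTotalDegree wt f ≤ n ↔ Dle (fun i => (wt i : ℤ)) f n := by
    intro f n
    simp only [weightedTotalDegree, Finset.sup_le_iff, mem_support_iff, Dle, hcast, Nat.cast_le]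
  have hd := deg_pos hW hΩ hirr
  have hp : Prime Ω := hirr.prime
  obtain ⟨ν, hν⟩ := exists_nu hW (Ideal.span {Ω - C ξ})
  refine ⟨ν, nu_top hW hν, fun c hc => nu_const hd hΩ hp hν c hc, nu_mul hW hd hΩ hp hν,
    nu_add hν, nu_bracket hW hΩ hw hν Pb hPb, ?_, ?_⟩
  · intro i a
    rw [hν, neg_neg]
    simp only [hdle]
    rfl
  · intro G _ _ PG 𝒢 φ h1 h2 h3 h4 h5 h6 h7 h8 h9
    exact gr_iso hW hd hΩ hp.ne_zero hw ξ Pb hPb PbΩ hPbΩ (valFilt ν) (fun i a => hν i a)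
      G PG 𝒢 φ h1 h2 h3 h4 h5 h6 h7 h8 h9
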